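/- arXiv:2412.02758 — 4 statements merged into one kernel-verified Lean document; each statement's English description precedes it below -/
import Mathlib

section
/- For any α > 0 and any compact set 𝒮 ⊂ 𝒦, there exists T̄ ∈ ℕ such that for all T ≥ T̄ and all K ∈ 𝒮, |J(K) − J_T(K)| ≤ α. -/
/-
Common definitions: LQR with system matrices `A`, `B` and cost matrices `Q`, `R`.
`fnorm` is the Frobenius norm, `frobInner` the Frobenius inner product.
`IsSchur M` means all eigenvalues of `M` lie in the open unit disk.
-/

noncomputable section
open Matrix

/-- Frobenius norm of a real matrix. -/
def fnorm {m n : ℕ} (M : Matrix (Fin m) (Fin n) ℝ) : ℝ :=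
  Real.sqrt (∑ i, ∑ j, (M i j) ^ 2)

/-- Frobenius inner product of two real matrices. -/
def frobInner {m n : ℕ} (X Y : Matrix (Fin m) (Fin n) ℝ) : ℝ :=
  ∑ i, ∑ j, X i j * Y i j

/-- A square matrix is Schur if all of its (complex) eigenvalues lie in the open
unit disk. -/
def IsSchur {n : ℕ} (M : Matrix (Fin n) (Fin n) ℝ) : Prop :=
  ∀ μ ∈ spectrum ℂ (M.map (algebraMap ℝ ℂ)), ‖μ‖ < 1

/-- The pair `(A, B)` is controllable: the columns of `B, AB, A²B, …` span `ℝⁿ`. -/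
def Controllable {n m : ℕ} (A : Matrix (Fin n) (Fin n) ℝ)
    (B : Matrix (Fin n) (Fin m) ℝ) : Prop :=
  Submodule.span ℝ {x : Fin n → ℝ | ∃ (t : ℕ) (j : Fin m), x = (A ^ t * B)ᵀ j} = ⊤

/-- Infinite-horizon LQR cost
`J(K) = (1/2) Tr Σ_{t=0}^∞ ((A+BK)ᵀ)^t (Q + KᵀRK) (A+BK)^t`. -/
def Jinf {n m : ℕ} (A : Matrix (Fin n) (Fin n) ℝ) (B : Matrix (Fin n) (Fin m) ℝ)
    (Q : Matrix (Fin n) (Fin n) ℝ) (R : Matrix (Fin m) (Fin m) ℝ)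
    (K : Matrix (Fin m) (Fin n) ℝ) : ℝ :=
  (1/2) * ∑' t : ℕ, (((A + B * K)ᵀ) ^ t * (Q + Kᵀ * R * K) * (A + B * K) ^ t).trace

/-- Truncated LQR cost
`J_T(K) = (1/2) Tr Σ_{t=0}^{T-1} ((A+BK)ᵀ)^t (Q + KᵀRK) (A+BK)^t`. -/
def Jtrunc {n m : ℕ} (A : Matrix (Fin n) (Fin n) ℝ) (B : Matrix (Fin n) (Fin m) ℝ)
    (Q : Matrix (Fin n) (Fin n) ℝ) (R : Matrix (Fin m) (Fin m) ℝ)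
    (T : ℕ) (K : Matrix (Fin m) (Fin n) ℝ) : ℝ :=
  (1/2) * ∑ t ∈ Finset.range T,
    (((A + B * K)ᵀ) ^ t * (Q + Kᵀ * R * K) * (A + B * K) ^ t).trace

section Auxiliary

open Filter Topology
open scoped NNReal ENNReal Matrix.Norms.Frobenius

/-- If `‖a ^ N‖ ≤ r ^ N` for some `N > 0`, then the powers of `a` decay geometrically at rate `r`. -/
lemma norm_pow_le_of_norm_pow_le {E : Type*} [NormedRing E] {a : E} {r C : ℝ} (hr : 0 < r)
    (hr1 : r ≤ 1) {N : ℕ} (hN : 0 < N) (hpow : ‖a ^ N‖ ≤ r ^ N) (hC : ∀ j < N, ‖a ^ j‖ ≤ C)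
    (t : ℕ) : ‖a ^ t‖ ≤ C / r ^ N * r ^ t := by
  induction t using Nat.strong_induction_on with
  | _ t ih =>
    rcases lt_or_ge t N with h | h
    · have hC0 : 0 ≤ C := (norm_nonneg _).trans (hC t h)
      calc ‖a ^ t‖ ≤ C := hC t h
        _ = C / r ^ N * r ^ N := by field_simp
        _ ≤ C / r ^ N * r ^ t := by
          gcongr ?_ * ?_
          exact pow_le_pow_of_le_one hr.le hr1 h.le
    · obtain ⟨s, rfl⟩ := Nat.exists_eq_add_of_le h
      calc ‖a ^ (N + s)‖ = ‖a ^ N * a ^ s‖ := by rw [pow_add]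
        _ ≤ ‖a ^ N‖ * ‖a ^ s‖ := norm_mul_le _ _
        _ ≤ r ^ N * (C / r ^ N * r ^ s) := by
          gcongr
          exact ih s (by omega)
        _ = C / r ^ N * r ^ (N + s) := by ring

/-- Consequence of Gelfand's formula for elements whose spectrum lies in the open unit disk. -/
lemma exists_norm_pow_lt_pow {E : Type*} [NormedRing E] [NormedAlgebra ℂ E] [CompleteSpace E]
    {a : E} (ha : ∀ μ ∈ spectrum ℂ a, ‖μ‖ < 1) :
    ∃ r : ℝ, 0 < r ∧ r < 1 ∧ ∃ N : ℕ, 0 < N ∧ ‖a ^ N‖ < r ^ N := by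
  have hrad : spectralRadius ℂ a < 1 := by
    rcases (spectrum ℂ a).eq_empty_or_nonempty with h | h
    · simp [spectralRadius, h]
    · exact_mod_cast spectrum.spectralRadius_lt_of_forall_lt_of_nonempty h (r := 1)
        fun μ hμ => by exact_mod_cast ha μ hμ
  obtain ⟨r, hr0, hr1⟩ := ENNReal.lt_iff_exists_nnreal_btwn.1 hrad
  obtain ⟨N, hN, hpos⟩ :=
    (((spectrum.pow_nnnorm_pow_one_div_tendsto_nhds_spectralRadius a).eventually_lt_const hr0).and
      (eventually_gt_atTop 0)).exists
  refine ⟨r, ?_, by exact_mod_cast hr1, N, hpos, ?_⟩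
  · exact_mod_cast ENNReal.coe_pos.1 (bot_le.trans_lt hr0)
  · rw [one_div, ENNReal.rpow_inv_lt_iff (by exact_mod_cast hpos), ENNReal.rpow_natCast] at hN
    exact_mod_cast hN

/-- Near a Schur matrix, powers decay geometrically with uniform constants. -/
lemma IsSchur.eventually_norm_pow_le {n : ℕ} {M₀ : Matrix (Fin n) (Fin n) ℝ} (h : IsSchur M₀) :
    ∃ C r : ℝ, 0 < r ∧ r < 1 ∧ ∀ᶠ M in 𝓝 M₀, ∀ t : ℕ, ‖M ^ t‖ ≤ C * r ^ t := by
  obtain ⟨r, hr0, hr1, N, hN, hlt⟩ := exists_norm_pow_lt_pow h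
  have hmap : ∀ M : Matrix (Fin n) (Fin n) ℝ, ‖M.map (algebraMap ℝ ℂ)‖ = ‖M‖ := fun M =>
    frobenius_norm_map_eq M _ fun a => by simp
  rw [← Matrix.map_pow, hmap] at hlt
  have hcont : ∀ j : ℕ, Continuous fun M : Matrix (Fin n) (Fin n) ℝ => ‖M ^ j‖ :=
    fun j => (continuous_pow j).norm
  refine ⟨(∑ j ∈ Finset.range N, (‖M₀ ^ j‖ + 1)) / r ^ N, r, hr0, hr1, ?_⟩
  have hfin : ∀ᶠ M in 𝓝 M₀, ∀ j ∈ Finset.range N, ‖M ^ j‖ < ‖M₀ ^ j‖ + 1 :=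
    (eventually_all_finset _).2 fun j _ =>
      (hcont j).continuousAt.eventually_lt_const (lt_add_one _)
  filter_upwards [(hcont N).continuousAt.eventually_lt_const hlt, hfin] with M hM hj
  refine norm_pow_le_of_norm_pow_le hr0 hr1.le hN hM.le fun j hjN => ?_
  exact (hj j (Finset.mem_range.2 hjN)).le.trans
    (Finset.single_le_sum (f := fun j => ‖M₀ ^ j‖ + 1) (fun i _ => by positivity)
      (Finset.mem_range.2 hjN))

/-- The trace is bounded by a multiple of the Frobenius norm. -/
lemma abs_trace_le_card_mul_norm {n : ℕ} (X : Matrix (Fin n) (Fin n) ℝ) :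
    |X.trace| ≤ n * ‖X‖ := by
  have hentry : ∀ i, |X i i| ≤ ‖X‖ := fun i =>
    (PiLp.norm_apply_le (WithLp.toLp 2 (X i)) i).trans
      (PiLp.norm_apply_le (WithLp.toLp 2 fun i => WithLp.toLp 2 (X i)) i)
  calc |X.trace| ≤ ∑ i, |X i i| := Finset.abs_sum_le_sum_abs _ _
    _ ≤ ∑ _i : Fin n, ‖X‖ := Finset.sum_le_sum fun i _ => hentry i
    _ = n * ‖X‖ := by simp

/-- Near a stabilizing gain, the stage costs are dominated by a common geometric sequence. -/
lemma exists_eventually_abs_stage_cost_le {n m : ℕ}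
    (A : Matrix (Fin n) (Fin n) ℝ) (B : Matrix (Fin n) (Fin m) ℝ)
    (Q : Matrix (Fin n) (Fin n) ℝ) (R : Matrix (Fin m) (Fin m) ℝ)
    {K₀ : Matrix (Fin m) (Fin n) ℝ} (h : IsSchur (A + B * K₀)) :
    ∃ u : ℕ → ℝ, Summable u ∧ ∀ᶠ K in 𝓝 K₀, ∀ t : ℕ,
      |(((A + B * K)ᵀ) ^ t * (Q + Kᵀ * R * K) * (A + B * K) ^ t).trace| ≤ u t := by
  obtain ⟨C, r, hr0, hr1, hpow⟩ := h.eventually_norm_pow_le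
  have hclosed : Continuous fun K : Matrix (Fin m) (Fin n) ℝ => A + B * K := by fun_prop
  have hweight : Continuous fun K : Matrix (Fin m) (Fin n) ℝ => ‖Q + Kᵀ * R * K‖ := by
    have : Continuous fun K : Matrix (Fin m) (Fin n) ℝ => Q + Kᵀ * R * K := by fun_prop
    exact this.norm
  set D := ‖Q + K₀ᵀ * R * K₀‖ + 1
  refine ⟨fun t => n * C ^ 2 * D * (r ^ 2) ^ t,
    (summable_geometric_of_lt_one (by positivity) (by nlinarith)).mul_left _, ?_⟩
  filter_upwards [hclosed.continuousAt.eventually hpow,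
    hweight.continuousAt.eventually_lt_const (lt_add_one _)] with K hK hW t
  have hCt : 0 ≤ C * r ^ t := (norm_nonneg _).trans (hK t)
  refine (abs_trace_le_card_mul_norm _).trans ?_
  calc n * ‖((A + B * K)ᵀ) ^ t * (Q + Kᵀ * R * K) * (A + B * K) ^ t‖
      ≤ n * (‖((A + B * K)ᵀ) ^ t‖ * ‖Q + Kᵀ * R * K‖ * ‖(A + B * K) ^ t‖) := by
        gcongr
        exact norm_mul₃_le
    _ ≤ n * ((C * r ^ t) * D * (C * r ^ t)) := by
        rw [← Matrix.transpose_pow, frobenius_norm_transpose]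
        gcongr
        exacts [hK t, hK t]
    _ = n * C ^ 2 * D * (r ^ 2) ^ t := by ring

/-- The partial sums of the stage costs converge uniformly on compact sets of stabilizing gains. -/
lemma tendstoUniformlyOn_stage_cost_sum {n m : ℕ}
    (A : Matrix (Fin n) (Fin n) ℝ) (B : Matrix (Fin n) (Fin m) ℝ)
    (Q : Matrix (Fin n) (Fin n) ℝ) (R : Matrix (Fin m) (Fin m) ℝ)
    {S : Set (Matrix (Fin m) (Fin n) ℝ)} (hS : IsCompact S)
    (hSsub : S ⊆ {K | IsSchur (A + B * K)}) :
    TendstoUniformlyOn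
      (fun T K => ∑ t ∈ Finset.range T,
        (((A + B * K)ᵀ) ^ t * (Q + Kᵀ * R * K) * (A + B * K) ^ t).trace)
      (fun K => ∑' t : ℕ, (((A + B * K)ᵀ) ^ t * (Q + Kᵀ * R * K) * (A + B * K) ^ t).trace)
      atTop S := by
  rw [← tendstoLocallyUniformlyOn_iff_tendstoUniformlyOn_of_compact hS]
  intro v hv K₀ hK₀
  obtain ⟨u, hu, hbound⟩ := exists_eventually_abs_stage_cost_le A B Q R (hSsub hK₀)
  refine ⟨_, mem_nhdsWithin_of_mem_nhds hbound, tendstoUniformlyOn_tsum_nat hu ?_ v hv⟩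
  exact fun t K hK => hK t

end Auxiliary

/-- Truncated cost approximation error: for any `α > 0` and any
compact set `𝒮` of stabilizing gains, there is `T̄ ∈ ℕ` such that
`|J(K) − J_T(K)| ≤ α` for all `T ≥ T̄` and all `K ∈ 𝒮`. -/
theorem truncated_cost_approximation {n m : ℕ}
    (A : Matrix (Fin n) (Fin n) ℝ) (B : Matrix (Fin n) (Fin m) ℝ)
    (Q : Matrix (Fin n) (Fin n) ℝ) (R : Matrix (Fin m) (Fin m) ℝ)
    (hQ : Q.PosDef) (hR : R.PosDef)
    (S : Set (Matrix (Fin m) (Fin n) ℝ)) (hScomp : IsCompact S)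
    (hSsub : S ⊆ {K | IsSchur (A + B * K)})
    (α : ℝ) (hα : 0 < α) :
    ∃ Tbar : ℕ, ∀ T : ℕ, Tbar ≤ T → ∀ K ∈ S,
      |Jinf A B Q R K - Jtrunc A B Q R T K| ≤ α := by
  obtain ⟨T₀, hT₀⟩ := Filter.eventually_atTop.1
    (Metric.tendstoUniformlyOn_iff.1 (tendstoUniformlyOn_stage_cost_sum A B Q R hScomp hSsub) α hα)
  refine ⟨T₀, fun T hT K hK => ?_⟩
  have hlt := hT₀ T hT K hK
  rw [Real.dist_eq] at hlt
  rw [Jinf, Jtrunc, ← mul_sub, abs_mul, abs_of_pos (by norm_num : (0 : ℝ) < 1 / 2)]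
  linarith
end
end

section
/- Let f : ℝ^n × ℕ → ℝ^n and suppose there exist N ∈ ℕ and f_av : ℝ^n → ℝ^n such that f_av(χ) = (1/N) Σ_{τ=k+1}^{k+N} f(χ, τ) for all χ ∈ ℝ^n and all k ∈ ℕ. Fix χ ∈ ℝ^n and L > 0 such that ‖f(χ, k)‖ ≤ L for all k ∈ ℕ and ‖f_av(χ)‖ ≤ L. Then, for all k ∈ ℕ, the function υ(χ, k) := Σ_{τ=0}^{k−1} ( f(χ, τ) − f_av(χ) ) satisfies ‖υ(χ, k)‖ ≤ 2 L N. -/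
noncomputable section

/-- Partial sums of a bounded sequence whose sums over all windows of length `N` vanish are
bounded by `N` times the bound of the sequence. -/
theorem norm_sum_range_le_of_sum_Icc_eq_zero {E : Type*} [SeminormedAddCommGroup E] {g : ℕ → E}
    {N : ℕ} {C : ℝ} (hN : 0 < N) (hg : ∀ k, ‖g k‖ ≤ C)
    (hsum : ∀ k, ∑ τ ∈ Finset.Icc (k + 1) (k + N), g τ = 0) (k : ℕ) :
    ‖∑ τ ∈ Finset.range k, g τ‖ ≤ N * C := by
  induction k using Nat.strong_induction_on with
  | _ k ih =>
    rcases le_or_gt k N with hk | hk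
    · have hC : 0 ≤ C := (norm_nonneg _).trans (hg 0)
      calc ‖∑ τ ∈ Finset.range k, g τ‖ ≤ ∑ _τ ∈ Finset.range k, C :=
            norm_sum_le_of_le _ fun τ _ => hg τ
        _ = k * C := by simp
        _ ≤ N * C := by gcongr
    · obtain ⟨m, rfl⟩ : ∃ m, k = m + 1 + N := ⟨k - N - 1, by omega⟩
      have hIcc : Finset.Icc (m + 1) (m + N) = Finset.Ico (m + 1) (m + 1 + N) := by
        ext τ
        simp only [Finset.mem_Icc, Finset.mem_Ico]
        omega
      rw [← Finset.sum_range_add_sum_Ico g (Nat.le_add_right (m + 1) N), ← hIcc, hsum m, add_zero]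
      exact ih (m + 1) (by omega)

/-- if `f_av(χ) = (1/N) Σ_{τ=k+1}^{k+N} f(χ,τ)` for all `χ` and `k`,
and at a fixed `χ` we have `‖f(χ,k)‖ ≤ L` for all `k` and `‖f_av(χ)‖ ≤ L`, then
`υ(χ,k) := Σ_{τ=0}^{k−1} (f(χ,τ) − f_av(χ))` satisfies `‖υ(χ,k)‖ ≤ 2LN` for all `k`. -/
theorem upsilon_bound {n : ℕ} (N : ℕ) (hN : 0 < N)
    (f : EuclideanSpace ℝ (Fin n) → ℕ → EuclideanSpace ℝ (Fin n))
    (fav : EuclideanSpace ℝ (Fin n) → EuclideanSpace ℝ (Fin n))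
    (hfav : ∀ (χ : EuclideanSpace ℝ (Fin n)) (k : ℕ),
      fav χ = ((N : ℝ)⁻¹) • ∑ τ ∈ Finset.Icc (k + 1) (k + N), f χ τ)
    (χ : EuclideanSpace ℝ (Fin n)) (L : ℝ) (hL : 0 < L)
    (hf : ∀ k : ℕ, ‖f χ k‖ ≤ L) (hfa : ‖fav χ‖ ≤ L) :
    ∀ k : ℕ, ‖∑ τ ∈ Finset.range k, (f χ τ - fav χ)‖ ≤ 2 * L * N := by
  intro k
  have hN' : (N : ℝ) ≠ 0 := by positivity
  have hwindow (k : ℕ) : ∑ τ ∈ Finset.Icc (k + 1) (k + N), (f χ τ - fav χ) = 0 := by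
    have hcard : (Finset.Icc (k + 1) (k + N)).card = N := by
      rw [Nat.card_Icc]
      omega
    rw [Finset.sum_sub_distrib, Finset.sum_const, hcard, ← Nat.cast_smul_eq_nsmul ℝ, hfav χ k,
      smul_inv_smul₀ hN', sub_self]
  have hbound (k : ℕ) : ‖f χ k - fav χ‖ ≤ 2 * L :=
    (norm_sub_le _ _).trans (by linarith [hf k])
  rw [mul_comm]
  exact norm_sum_range_le_of_sum_Icc_eq_zero hN hbound hwindow k
end
end

section
/- Let f : ℝ^n × ℕ → ℝ^n admit an averaged map f_av : ℝ^n → ℝ^n with f_av(χ) = (1/N) Σ_{τ=k+1}^{k+N} f(χ, τ) for all χ and k, and let χ^{k+1} = χ^k + γ f(χ^k, k) and χ_av^{k+1} = χ_av^k + γ f_av(χ_av^k) be started from the same initial condition χ^0 = χ_av^0 = χ₀. Define υ(χ, k) := Σ_{τ=0}^{k−1}( f(χ, τ) − f_av(χ) ). Fix k ∈ ℕ, γ ∈ (0,1], and L > 0, and suppose that for all τ ≤ k and all points χ, χ′ among {χ^τ, χ_av^τ, χ_av^τ + γ υ(χ_av^τ, τ) : τ ≤ k} the following hold: ‖f(χ,τ)‖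 ≤ L, ‖f_av(χ)‖ ≤ L, ‖f(χ,τ) − f(χ′,τ)‖ ≤ L‖χ − χ′‖, ‖f_av(χ) − f_av(χ′)‖ ≤ L‖χ − χ′‖, ‖υ(χ,τ)‖ ≤ 2LN, and ‖υ(χ,τ) − υ(χ′,τ)‖ ≤ 2LN‖χ − χ′‖. Then ‖χ^k − χ_av^k‖ ≤ 2 γ² L² (1 + 2N) k + 2 γ L (1 + 2N) exp(γ L k) + 2 γ L N. -/
noncomputable section

/-- A discrete Grönwall inequality: an affine recursive bound `e (τ + 1) ≤ (1 + a) e τ + a c`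
up to time `k`, started from `e 0 ≤ 0`, gives `e k ≤ c ((1 + a)^k - 1)`. -/
theorem le_mul_one_add_pow_sub_one {e : ℕ → ℝ} {a c : ℝ} {k : ℕ} (ha : 0 ≤ a) (h0 : e 0 ≤ 0)
    (hstep : ∀ τ < k, e (τ + 1) ≤ (1 + a) * e τ + a * c) :
    e k ≤ c * ((1 + a) ^ k - 1) := by
  induction k with
  | zero => simpa using h0
  | succ k ih =>
    calc e (k + 1) ≤ (1 + a) * e k + a * c := hstep k k.lt_succ_self
      _ ≤ (1 + a) * (c * ((1 + a) ^ k - 1)) + a * c := by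
        gcongr
        exact ih fun τ hτ => hstep τ (hτ.trans k.lt_succ_self)
      _ = c * ((1 + a) ^ (k + 1) - 1) := by ring

/-- closeness of the trajectories of the time-varying system
`χ^{k+1} = χ^k + γ f(χ^k, k)` and of its averaged system
`χ_av^{k+1} = χ_av^k + γ f_av(χ_av^k)` started from the same initial condition,
under boundedness and Lipschitz assumptions holding at the relevant points:
`‖χ^k − χ_av^k‖ ≤ 2γ²L²(1+2N)k + 2γL(1+2N)exp(γLk) + 2γLN`. -/
theorem trajectory_closeness {n : ℕ} (N : ℕ) (hN : 0 < N)
    (f : EuclideanSpace ℝ (Fin n) → ℕ → EuclideanSpace ℝ (Fin n))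
    (fav : EuclideanSpace ℝ (Fin n) → EuclideanSpace ℝ (Fin n))
    (hfav : ∀ (χ : EuclideanSpace ℝ (Fin n)) (k : ℕ),
      fav χ = ((N : ℝ)⁻¹) • ∑ τ ∈ Finset.Icc (k + 1) (k + N), f χ τ)
    (γ : ℝ) (hγ0 : 0 < γ) (hγ1 : γ ≤ 1)
    (χ₀ : EuclideanSpace ℝ (Fin n)) (χ χav : ℕ → EuclideanSpace ℝ (Fin n))
    (hχ0 : χ 0 = χ₀) (hχav0 : χav 0 = χ₀)
    (hχ : ∀ k : ℕ, χ (k + 1) = χ k + γ • f (χ k) k)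
    (hχav : ∀ k : ℕ, χav (k + 1) = χav k + γ • fav (χav k))
    -- `υ(χ, k) := Σ_{τ=0}^{k−1} (f(χ,τ) − f_av(χ))`
    (υ : EuclideanSpace ℝ (Fin n) → ℕ → EuclideanSpace ℝ (Fin n))
    (hυ : ∀ (x : EuclideanSpace ℝ (Fin n)) (k : ℕ),
      υ x k = ∑ τ ∈ Finset.range k, (f x τ - fav x))
    (k : ℕ) (L : ℝ) (hL : 0 < L)
    -- the set of relevant points `{χ^τ, χ_av^τ, χ_av^τ + γ υ(χ_av^τ, τ) : τ ≤ k}`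
    (P : Set (EuclideanSpace ℝ (Fin n)))
    (hP : P = {x | ∃ τ ≤ k, x = χ τ ∨ x = χav τ ∨ x = χav τ + γ • υ (χav τ) τ})
    (hb1 : ∀ τ ≤ k, ∀ x ∈ P, ‖f x τ‖ ≤ L)
    (hb2 : ∀ x ∈ P, ‖fav x‖ ≤ L)
    (hb3 : ∀ τ ≤ k, ∀ x ∈ P, ∀ y ∈ P, ‖f x τ - f y τ‖ ≤ L * ‖x - y‖)
    (hb4 : ∀ x ∈ P, ∀ y ∈ P, ‖fav x - fav y‖ ≤ L * ‖x - y‖)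
    (hb5 : ∀ τ ≤ k, ∀ x ∈ P, ‖υ x τ‖ ≤ 2 * L * N)
    (hb6 : ∀ τ ≤ k, ∀ x ∈ P, ∀ y ∈ P, ‖υ x τ - υ y τ‖ ≤ 2 * L * N * ‖x - y‖) :
    ‖χ k - χav k‖ ≤ 2 * γ ^ 2 * L ^ 2 * (1 + 2 * N) * k
      + 2 * γ * L * (1 + 2 * N) * Real.exp (γ * L * k) + 2 * γ * L * N := by
  have memχ : ∀ τ ≤ k, χ τ ∈ P := fun τ hτ => hP ▸ ⟨τ, hτ, Or.inl rfl⟩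
  have memav : ∀ τ ≤ k, χav τ ∈ P := fun τ hτ => hP ▸ ⟨τ, hτ, Or.inr (Or.inl rfl)⟩
  have memξ : ∀ τ ≤ k, χav τ + γ • υ (χav τ) τ ∈ P :=
    fun τ hτ => hP ▸ ⟨τ, hτ, Or.inr (Or.inr rfl)⟩
  have hγυ : ∀ τ ≤ k, ‖γ • υ (χav τ) τ‖ ≤ γ * (2 * L * N) := fun τ hτ => by
    rw [norm_smul, Real.norm_of_nonneg hγ0.le]
    gcongr
    exact hb5 τ hτ _ (memav τ hτ)
  have hstep : ∀ τ < k, ‖χ (τ + 1) - (χav (τ + 1) + γ • υ (χav (τ + 1)) (τ + 1))‖ ≤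
      (1 + γ * L) * ‖χ τ - (χav τ + γ • υ (χav τ) τ)‖ + γ * L * (4 * γ * L * N) := by
    intro τ hτ
    set ξ := χav τ + γ • υ (χav τ) τ with hξ
    have hdecomp : χ (τ + 1) - (χav (τ + 1) + γ • υ (χav (τ + 1)) (τ + 1)) =
        (χ τ - ξ) + γ • ((f (χ τ) τ - f ξ τ) + (f ξ τ - f (χav τ) τ)
          - (υ (χav (τ + 1)) (τ + 1) - υ (χav τ) (τ + 1))) := by
      have hυsucc : υ (χav τ) (τ + 1) = υ (χav τ) τ + (f (χav τ) τ - fav (χav τ)) := by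
        rw [hυ, hυ, Finset.sum_range_succ]
      rw [hυsucc, hξ, hχ τ]
      nth_rewrite 1 [hχav τ]
      module
    have hf : ‖f (χ τ) τ - f ξ τ‖ ≤ L * ‖χ τ - ξ‖ :=
      hb3 τ hτ.le _ (memχ τ hτ.le) _ (memξ τ hτ.le)
    have hfξ : ‖f ξ τ - f (χav τ) τ‖ ≤ L * (γ * (2 * L * N)) := by
      refine (hb3 τ hτ.le _ (memξ τ hτ.le) _ (memav τ hτ.le)).trans ?_
      rw [add_sub_cancel_left]
      gcongr
      exact hγυ τ hτ.le
    have hυdiff : ‖υ (χav (τ + 1)) (τ + 1) - υ (χav τ) (τ + 1)‖ ≤ 2 * L * N * (γ * L) := by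
      refine (hb6 (τ + 1) hτ _ (memav _ hτ) _ (memav τ hτ.le)).trans ?_
      rw [hχav τ, add_sub_cancel_left, norm_smul, Real.norm_of_nonneg hγ0.le]
      gcongr
      exact hb2 _ (memav τ hτ.le)
    calc _ ≤ ‖χ τ - ξ‖ + γ * (‖f (χ τ) τ - f ξ τ‖ + ‖f ξ τ - f (χav τ) τ‖
          + ‖υ (χav (τ + 1)) (τ + 1) - υ (χav τ) (τ + 1)‖) := by
          rw [hdecomp]
          refine (norm_add_le _ _).trans ?_
          rw [norm_smul, Real.norm_of_nonneg hγ0.le]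
          gcongr
          exact (norm_sub_le _ _).trans (by gcongr; exact norm_add_le _ _)
      _ ≤ ‖χ τ - ξ‖ + γ * (L * ‖χ τ - ξ‖ + L * (γ * (2 * L * N)) + 2 * L * N * (γ * L)) := by
          gcongr
      _ = _ := by ring
  have hgronwall := le_mul_one_add_pow_sub_one
    (e := fun τ => ‖χ τ - (χav τ + γ • υ (χav τ) τ)‖) (mul_nonneg hγ0.le hL.le)
    (by simp [hχ0, hχav0, hυ]) hstep
  have hexp : (1 + γ * L) ^ k ≤ Real.exp (γ * L * k) := by
    calc (1 + γ * L) ^ k ≤ Real.exp (γ * L) ^ k := by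
          gcongr
          linarith [Real.add_one_le_exp (γ * L)]
      _ = Real.exp (γ * L * k) := by rw [← Real.exp_nat_mul, mul_comm]
  calc ‖χ k - χav k‖
      = ‖(χ k - (χav k + γ • υ (χav k) k)) + γ • υ (χav k) k‖ := by congr 1; abel
    _ ≤ 4 * γ * L * N * ((1 + γ * L) ^ k - 1) + γ * (2 * L * N) :=
        (norm_add_le _ _).trans (add_le_add hgronwall (hγυ k le_rfl))
    _ ≤ 4 * γ * L * N * Real.exp (γ * L * k) + γ * (2 * L * N) := by
        gcongr
        linarith
    _ ≤ _ := by
        have h₁ : 0 ≤ 2 * γ ^ 2 * L ^ 2 * (1 + 2 * N) * k := by positivity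
        have h₂ : 0 ≤ 2 * γ * L * Real.exp (γ * L * k) := by positivity
        linarith
end
end

section
/- Let γ ∈ (0,1], κ > 0, ℓ > 0, ℓ_e > 0, δ ∈ (0,1], and let ζ̃ ∈ ℝ, g ∈ ℝ, and G, p be matrices with ‖g‖ ≤ γ ℓ (‖G‖ + ‖p‖) and ‖p‖ ≤ δ² ℓ_e. Define ζ̃⁺ := (1 − γ) ζ̃ + g. Then (1/2)|ζ̃⁺|² − (1/2)|ζ̃|² ≤ −γ(1 − γ(1+κ)/2)|ζ̃|² + (1 − γ) γ ℓ |ζ̃| ‖G‖ + γ² ℓ² ‖G‖² + δ⁴ ( γ² + (1 − γ)²/(2κ) ) ℓ² ℓ_e². -/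
noncomputable section

/-- decrease estimate for the filter-error coordinate: if
`ζ̃⁺ := (1 − γ)ζ̃ + g` with `|g| ≤ γℓ(‖G‖ + ‖p‖)` and `‖p‖ ≤ δ²ℓ_e`, then
`(1/2)|ζ̃⁺|² − (1/2)|ζ̃|² ≤ −γ(1 − γ(1+κ)/2)|ζ̃|² + (1−γ)γℓ|ζ̃|‖G‖ + γ²ℓ²‖G‖²
  + δ⁴(γ² + (1−γ)²/(2κ))ℓ²ℓ_e²`. -/
theorem filter_error_decrease {a b : ℕ}
    (γ κ l le δ : ℝ)
    (hγ0 : 0 < γ) (hγ1 : γ ≤ 1) (hκ : 0 < κ) (hl : 0 < l) (hle : 0 < le)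
    (hδ0 : 0 < δ) (hδ1 : δ ≤ 1)
    (ζ g : ℝ) (G p : Matrix (Fin a) (Fin b) ℝ)
    (hg : |g| ≤ γ * l * (fnorm G + fnorm p)) (hp : fnorm p ≤ δ ^ 2 * le) :
    (1/2) * |(1 - γ) * ζ + g| ^ 2 - (1/2) * |ζ| ^ 2 ≤
      -(γ * (1 - γ * (1 + κ) / 2)) * |ζ| ^ 2
      + (1 - γ) * γ * l * |ζ| * fnorm G
      + γ ^ 2 * l ^ 2 * (fnorm G) ^ 2
      + δ ^ 4 * (γ ^ 2 + (1 - γ) ^ 2 / (2 * κ)) * l ^ 2 * le ^ 2 := by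
  generalize fnorm G = x at *
  generalize fnorm p = y at *
  have hγ : 0 ≤ 1 - γ := by linarith
  have hgl : 0 ≤ γ * l := by positivity
  have hg' : |g| ≤ γ * l * (x + δ ^ 2 * le) :=
    hg.trans (by gcongr)
  have hsq : g ^ 2 ≤ (γ * l * (x + δ ^ 2 * le)) ^ 2 := by
    rw [← sq_abs g]
    gcongr
  have hcross : (1 - γ) * (ζ * g) ≤ (1 - γ) * (|ζ| * (γ * l * (x + δ ^ 2 * le))) := by
    refine mul_le_mul_of_nonneg_left ?_ hγ
    calc ζ * g ≤ |ζ * g| := le_abs_self _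
      _ = |ζ| * |g| := abs_mul _ _
      _ ≤ _ := by gcongr
  have hyoung : (1 - γ) * |ζ| * γ * l * (δ ^ 2 * le) ≤
      κ * γ ^ 2 * |ζ| ^ 2 / 2 + (1 - γ) ^ 2 / (2 * κ) * (l ^ 2 * δ ^ 4 * le ^ 2) := by
    have h : κ * γ ^ 2 * |ζ| ^ 2 / 2 + (1 - γ) ^ 2 / (2 * κ) * (l ^ 2 * δ ^ 4 * le ^ 2)
        - (1 - γ) * |ζ| * γ * l * (δ ^ 2 * le)
        = (κ * γ * |ζ| - (1 - γ) * l * δ ^ 2 * le) ^ 2 / (2 * κ) := by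
      field_simp
      ring
    have h' : 0 ≤ (κ * γ * |ζ| - (1 - γ) * l * δ ^ 2 * le) ^ 2 / (2 * κ) := by positivity
    linarith
  have hsum : (γ * l * (x + δ ^ 2 * le)) ^ 2 ≤
      2 * (γ ^ 2 * l ^ 2 * x ^ 2 + γ ^ 2 * l ^ 2 * δ ^ 4 * le ^ 2) := by
    linarith [sq_nonneg (γ * l * (x - δ ^ 2 * le))]
  have hζ : |ζ| ^ 2 = ζ ^ 2 := sq_abs ζ
  have hexp : |(1 - γ) * ζ + g| ^ 2 =
      (1 - γ) ^ 2 * |ζ| ^ 2 + 2 * ((1 - γ) * (ζ * g)) + g ^ 2 := by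
    rw [sq_abs, hζ]
    ring
  rw [hexp]
  linarith
end
end
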